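/- Let ρ = e^{−V} be a probability density on ℝⁿ with V : ℝⁿ → ℝ convex, let δ > 0 and m ∈ ℝⁿ, and let μ_{m,δ} be the probability measure with density proportional to e^{−δ|x−m|²/2} ρ(x). Then for every unit vector σ ∈ ℝⁿ, the variance of the linear functional x ↦ ⟨σ, x⟩ under μ_{m,δ} is strictly less than 1/δ. -/

import Mathlib

open MeasureTheory RealInnerProductSpace
open scoped ENNReal Pointwise

/-- The one-dimensional Brunn-Minkowski inequality. -/
theorem volume_add_volume_le_of_add_subset {A B C : Set ℝ} (hA : MeasurableSet A)
    (hB : MeasurableSet B) (hA₀ : A.Nonempty) (hB₀ : B.Nonempty) (hC : A + B ⊆ C) :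
    volume A + volume B ≤ volume C := by
  obtain ⟨x₀, hx₀⟩ := hA₀
  obtain ⟨y₀, hy₀⟩ := hB₀
  have key : ∀ K ⊆ A, IsCompact K → ∀ L ⊆ B, IsCompact L → volume K + volume L ≤ volume C := by
    intro K hKA hK L hLB hL
    obtain ⟨x, hx, hxK⟩ := (hK.insert x₀).exists_isGreatest (Set.insert_nonempty _ _)
    obtain ⟨y, hy, hyL⟩ := (hL.insert y₀).exists_isLeast (Set.insert_nonempty _ _)
    have hxA : x ∈ A := Set.insert_subset hx₀ hKA hx
    have hyB : y ∈ B := Set.insert_subset hy₀ hLB hy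
    have hdisj : AEDisjoint volume ((· + y) '' K) ((x + ·) '' L) := by
      refine measure_mono_null (t := {x + y}) ?_ (by simp)
      rintro _ ⟨⟨k, hk, rfl⟩, l, hl, hkl⟩
      have h₁ := hxK (Set.mem_insert_of_mem _ hk)
      have h₂ := hyL (Set.mem_insert_of_mem _ hl)
      simp only [Set.mem_singleton_iff] at *
      linarith
    calc volume K + volume L = volume ((· + y) '' K) + volume ((x + ·) '' L) := by
          simp
      _ = volume ((· + y) '' K ∪ (x + ·) '' L) :=
          (measure_union₀ (hL.image (by fun_prop)).measurableSet.nullMeasurableSet hdisj).symm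
      _ ≤ volume C := by
          refine measure_mono (Set.Subset.trans ?_ hC)
          rintro _ (⟨k, hk, rfl⟩ | ⟨l, hl, rfl⟩)
          · exact Set.add_mem_add (hKA hk) hyB
          · exact Set.add_mem_add hxA (hLB hl)
  rw [hA.measure_eq_iSup_isCompact, hB.measure_eq_iSup_isCompact]
  simp only [iSup_and']
  exact ENNReal.biSup_add_biSup_le' ⟨∅, by simp⟩ ⟨∅, by simp⟩
    fun K hK L hL => key K hK.1 hK.2 L hL.1 hL.2

theorem lintegral_eq_lintegral_Ioo_of_le_one {f : ℝ → ℝ≥0∞} (hf : Measurable f)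
    (hf₁ : ∀ x, f x ≤ 1) :
    ∫⁻ x, f x = ∫⁻ t in Set.Ioo (0 : ℝ) 1, volume {x | ENNReal.ofReal t < f x} := by
  have htop : ∀ x, f x ≠ ∞ := fun x => ((hf₁ x).trans_lt ENNReal.one_lt_top).ne
  have h := lintegral_eq_lintegral_meas_lt (volume : Measure ℝ) (f := fun x => (f x).toReal)
    (by filter_upwards with x using ENNReal.toReal_nonneg) hf.ennreal_toReal.aemeasurable
  simp only [ENNReal.ofReal_toReal (htop _)] at h
  rw [h, ← lintegral_indicator measurableSet_Ioi, ← lintegral_indicator measurableSet_Ioo]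
  refine lintegral_congr fun t => ?_
  by_cases ht : 0 < t
  · by_cases ht' : t < 1
    · simp [ht, ht', ENNReal.ofReal_lt_iff_lt_toReal ht.le (htop _)]
    · have : {x | t < (f x).toReal} = ∅ := by
        ext x
        simpa using (ENNReal.toReal_mono ENNReal.one_ne_top (hf₁ x)).trans (by simpa using ht')
      simp [ht', this]
  · simp [ht]

theorem ENNReal.geom_mean_le_arith_mean_two_weighted {a b : ℝ} (ha : 0 < a) (hb : 0 < b)
    (hab : a + b = 1) (x y : ℝ≥0∞) :
    x ^ a * y ^ b ≤ ENNReal.ofReal a * x + ENNReal.ofReal b * y := by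
  by_cases hx : x = ∞
  · simp [hx, ha]
  by_cases hy : y = ∞
  · simp [hy, hb]
  lift x to NNReal using hx
  lift y to NNReal using hy
  lift a to NNReal using ha.le
  lift b to NNReal using hb.le
  rw [← ENNReal.coe_rpow_of_nonneg _ ha.le, ← ENNReal.coe_rpow_of_nonneg _ hb.le]
  simp only [ENNReal.ofReal_coe_nnreal]
  exact_mod_cast NNReal.geom_mean_le_arith_mean2_weighted a b x y (by exact_mod_cast hab)

theorem lintegral_add_lintegral_le_of_iSup_eq_one {a b : ℝ} (ha : 0 < a) (hb : 0 < b)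
    (hab : a + b = 1) {f g h : ℝ → ℝ≥0∞} (hf : Measurable f) (hg : Measurable g)
    (hh : Measurable h) (hf₁ : ⨆ x, f x = 1) (hg₁ : ⨆ x, g x = 1)
    (hfgh : ∀ x y, f x ^ a * g y ^ b ≤ h (a • x + b • y)) :
    ENNReal.ofReal a * (∫⁻ x, f x) + ENNReal.ofReal b * (∫⁻ x, g x) ≤ ∫⁻ x, h x := by
  have hle : ∫⁻ x, min (h x) 1 ≤ ∫⁻ x, h x := lintegral_mono fun x => min_le_left _ _
  refine le_trans ?_ hle
  rw [lintegral_eq_lintegral_Ioo_of_le_one hf fun x => hf₁ ▸ le_iSup f x,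
    lintegral_eq_lintegral_Ioo_of_le_one hg fun x => hg₁ ▸ le_iSup g x,
    lintegral_eq_lintegral_Ioo_of_le_one (hh.min measurable_const) fun x => min_le_right _ _]
  have hanti (f : ℝ → ℝ≥0∞) : Measurable fun t : ℝ => volume {x | ENNReal.ofReal t < f x} := by
    refine Antitone.measurable fun s t hst => measure_mono ?_
    exact Set.ofPred_subset_ofPred.2 fun x hx => (ENNReal.ofReal_le_ofReal hst).trans_lt hx
  rw [← lintegral_const_mul _ (hanti f), ← lintegral_const_mul _ (hanti g),
    ← lintegral_add_left ((hanti f).const_mul _)]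
  refine setLIntegral_mono (hanti _) fun t ht => ?_
  have hvol (c : ℝ) (hc : 0 < c) (s : Set ℝ) :
      ENNReal.ofReal c * volume s = volume (c • s) := by
    simp [Measure.addHaar_smul, abs_of_pos hc]
  have ht₁ : ENNReal.ofReal t < 1 := by simpa using ht.2
  have hne {f : ℝ → ℝ≥0∞} (hf : ⨆ x, f x = 1) : {x | ENNReal.ofReal t < f x}.Nonempty := by
    obtain ⟨x, hx⟩ := lt_iSup_iff.1 (hf ▸ ht₁)
    exact ⟨x, hx⟩
  rw [hvol a ha, hvol b hb]
  refine volume_add_volume_le_of_add_subset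
    ((measurableSet_lt measurable_const hf).const_smul₀ a)
    ((measurableSet_lt measurable_const hg).const_smul₀ b)
    (Set.Nonempty.smul_set (hne hf₁)) (Set.Nonempty.smul_set (hne hg₁)) ?_
  rintro _ ⟨_, ⟨x, hx, rfl⟩, _, ⟨y, hy, rfl⟩, rfl⟩
  refine lt_min (lt_of_lt_of_le ?_ (hfgh x y)) ht₁
  calc ENNReal.ofReal t = ENNReal.ofReal t ^ a * ENNReal.ofReal t ^ b := by
        rw [← ENNReal.rpow_add_of_nonneg _ _ ha.le hb.le, hab, ENNReal.rpow_one]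
    _ < f x ^ a * g y ^ b :=
        ENNReal.mul_lt_mul (ENNReal.rpow_lt_rpow hx ha) (ENNReal.rpow_lt_rpow hy hb)

/-- The Prékopa-Leindler property of a measure, for the weights `a` and `b`. -/
def PrekopaLeindler {E : Type*} [AddCommMonoid E] [Module ℝ E] [MeasurableSpace E]
    (a b : ℝ) (μ : Measure E) : Prop :=
  ∀ ⦃f g h : E → ℝ≥0∞⦄, Measurable f → Measurable g → Measurable h →
    (∀ x y, f x ^ a * g y ^ b ≤ h (a • x + b • y)) →
    (∫⁻ x, f x ∂μ) ^ a * (∫⁻ x, g x ∂μ) ^ b ≤ ∫⁻ x, h x ∂μ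

theorem prekopaLeindler_real_of_bounded {a b : ℝ} (ha : 0 < a) (hb : 0 < b)
    (hab : a + b = 1) {f g h : ℝ → ℝ≥0∞} (hf : Measurable f) (hg : Measurable g)
    (hh : Measurable h) (hf₁ : ⨆ x, f x ≠ ∞) (hg₁ : ⨆ x, g x ≠ ∞)
    (hfgh : ∀ x y, f x ^ a * g y ^ b ≤ h (a • x + b • y)) :
    (∫⁻ x, f x) ^ a * (∫⁻ x, g x) ^ b ≤ ∫⁻ x, h x := by
  by_cases hM : ⨆ x, f x = 0
  · have : ∀ x, f x = 0 := by simpa using hM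
    simp [this, ha]
  by_cases hN : ⨆ x, g x = 0
  · have : ∀ x, g x = 0 := by simpa using hN
    simp [this, hb]
  set M := ⨆ x, f x
  set N := ⨆ x, g x
  have hMa : M ^ a ≠ 0 ∧ M ^ a ≠ ∞ := by simp [hM, hf₁, ha.not_gt, ha]
  have hNb : N ^ b ≠ 0 ∧ N ^ b ≠ ∞ := by simp [hN, hg₁, hb.not_gt, hb]
  have hc₀ : M ^ a * N ^ b ≠ 0 := mul_ne_zero hMa.1 hNb.1
  have hc : M ^ a * N ^ b ≠ ∞ := ENNReal.mul_ne_top hMa.2 hNb.2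
  have hinv (u v : ℝ≥0∞) : (M⁻¹ * u) ^ a * (N⁻¹ * v) ^ b
      = (M ^ a * N ^ b)⁻¹ * (u ^ a * v ^ b) := by
    rw [ENNReal.mul_rpow_of_nonneg _ _ ha.le, ENNReal.mul_rpow_of_nonneg _ _ hb.le,
      ENNReal.inv_rpow, ENNReal.inv_rpow, ENNReal.mul_inv (.inl hMa.1) (.inl hMa.2)]
    ring
  have := lintegral_add_lintegral_le_of_iSup_eq_one ha hb hab (f := fun x => M⁻¹ * f x)
    (g := fun x => N⁻¹ * g x) (h := fun x => (M ^ a * N ^ b)⁻¹ * h x)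
    (hf.const_mul _) (hg.const_mul _) (hh.const_mul _)
    (by rw [← ENNReal.mul_iSup, ENNReal.inv_mul_cancel hM hf₁])
    (by rw [← ENNReal.mul_iSup, ENNReal.inv_mul_cancel hN hg₁])
    (fun x y => by rw [hinv]; gcongr; exact hfgh x y)
  have := (ENNReal.geom_mean_le_arith_mean_two_weighted ha hb hab _ _).trans this
  rw [lintegral_const_mul _ hf, lintegral_const_mul _ hg, lintegral_const_mul _ hh, hinv] at this
  exact (ENNReal.mul_le_mul_iff_right (ENNReal.inv_ne_zero.2 hc) (ENNReal.inv_ne_top.2 hc₀)).1 this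

theorem prekopaLeindler_real {a b : ℝ} (ha : 0 < a) (hb : 0 < b) (hab : a + b = 1) :
    PrekopaLeindler a b (volume : Measure ℝ) := by
  intro f g h hf hg hh hfgh
  have htrunc {f : ℝ → ℝ≥0∞} (hf : Measurable f) {c : ℝ} (hc : 0 < c) :
      (∫⁻ x, f x) ^ c = ⨆ n : ℕ, (∫⁻ x, min (f x) n) ^ c := by
    have : ∀ x, f x = ⨆ n : ℕ, min (f x) n := fun x => by
      rw [← inf_iSup_eq, ENNReal.iSup_natCast, inf_top_eq]
    rw [lintegral_congr this]
    rw [lintegral_iSup (fun n => hf.min measurable_const)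
      fun m n hmn x => min_le_min le_rfl (by exact_mod_cast hmn)]
    exact (ENNReal.orderIsoRpow c hc).map_iSup _
  have hbdd (f : ℝ → ℝ≥0∞) (n : ℕ) : ⨆ x, min (f x) n ≠ ∞ :=
    ((iSup_le fun x => min_le_right _ _).trans_lt (ENNReal.natCast_lt_top n)).ne
  rw [htrunc hf ha, htrunc hg hb]
  simp only [ENNReal.iSup_mul, ENNReal.mul_iSup, iSup_le_iff]
  refine fun m n => prekopaLeindler_real_of_bounded ha hb hab (hf.min measurable_const)
    (hg.min measurable_const) hh (hbdd f _) (hbdd g _) fun x y => le_trans ?_ (hfgh x y)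
  gcongr <;> exact min_le_left _ _

theorem PrekopaLeindler.prod {a b : ℝ} {E F : Type*} [AddCommMonoid E] [Module ℝ E]
    [MeasurableSpace E] [AddCommMonoid F] [Module ℝ F] [MeasurableSpace F] {μ : Measure E}
    {ν : Measure F} [SFinite μ] [SFinite ν] (hμ : PrekopaLeindler a b μ)
    (hν : PrekopaLeindler a b ν) : PrekopaLeindler a b (μ.prod ν) := by
  intro f g h hf hg hh hfgh
  rw [lintegral_prod _ hf.aemeasurable, lintegral_prod _ hg.aemeasurable,
    lintegral_prod _ hh.aemeasurable]
  exact hμ hf.lintegral_prod_right' hg.lintegral_prod_right' hh.lintegral_prod_right'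
    fun x y => hν (hf.comp measurable_prodMk_left) (hg.comp measurable_prodMk_left)
      (hh.comp measurable_prodMk_left) fun z w => hfgh (x, z) (y, w)

theorem prekopaLeindler_pi {a b : ℝ} (ha : 0 < a) (hb : 0 < b) (hab : a + b = 1) (n : ℕ) :
    PrekopaLeindler a b (volume : Measure (Fin n → ℝ)) := by
  induction n with
  | zero =>
    intro f g h hf hg hh hfgh
    have : (volume : Measure (Fin 0 → ℝ)) = Measure.dirac 0 := by
      rw [volume_pi]; exact Measure.pi_of_empty _ _
    simpa [this] using hfgh 0 0
  | succ n ih =>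
    intro f g h hf hg hh hfgh
    have hmp := (volume_preserving_piFinSuccAbove (fun _ : Fin (n + 1) => ℝ) 0).symm
    have hm := (MeasurableEquiv.piFinSuccAbove (fun _ : Fin (n + 1) => ℝ) 0).symm.measurable
    rw [← hmp.lintegral_comp hf, ← hmp.lintegral_comp hg, ← hmp.lintegral_comp hh]
    refine (prekopaLeindler_real ha hb hab).prod ih (hf.comp hm) (hg.comp hm) (hh.comp hm) ?_
    rintro ⟨x, z⟩ ⟨y, w⟩
    refine (hfgh _ _).trans_eq (congrArg h ?_)
    ext i
    refine Fin.cases ?_ (fun i => ?_) i <;> simp [MeasurableEquiv.piFinSuccAbove, Fin.insertNthEquiv]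

theorem integral_sq_withDensity_lt_of_ordConnected {γ : Measure ℝ} [IsProbabilityMeasure γ]
    [NullSingletonClass γ] {k : ℝ → ℝ≥0∞} [IsProbabilityMeasure (γ.withDensity k)] (hγ : MemLp id 2 γ)
    (hk : Measurable k) (hk₁ : {x | 1 < k x}.OrdConnected) (hν : MemLp id 2 (γ.withDensity k))
    (hmean : ∫ x, x ∂γ.withDensity k = ∫ x, x ∂γ) (hne : ¬ ∀ᵐ x ∂γ, k x = 1) :
    ∫ x, x ^ 2 ∂γ.withDensity k < ∫ x, x ^ 2 ∂γ := by
  set A := {x | 1 < k x}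
  have hfin : ∀ᵐ x ∂γ, k x < ∞ := by
    refine ae_lt_top hk ?_
    rw [← setLIntegral_univ, ← withDensity_apply _ MeasurableSet.univ]
    exact measure_ne_top _ _
  have hdiff {q : ℝ → ℝ} (h₁ : Integrable q γ) (h₂ : Integrable q (γ.withDensity k)) :
      Integrable (fun x => q x * ((k x).toReal - 1)) γ ∧
      ∫ x, q x * ((k x).toReal - 1) ∂γ = ∫ x, q x ∂γ.withDensity k - ∫ x, q x ∂γ := by
    have h₃ := (integrable_withDensity_iff_integrable_smul' hk hfin).1 h₂
    have h₄ : (fun x => q x * ((k x).toReal - 1)) = fun x => (k x).toReal • q x - q x := by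
      ext x; simp; ring
    rw [h₄, integral_sub h₃ h₁, integral_withDensity_eq_integral_toReal_smul hk hfin]
    exact ⟨h₃.sub h₁, rfl⟩
  have hquad {ν : Measure ℝ} [IsProbabilityMeasure ν] (h : MemLp id 2 ν) (c₂ c₁ c₀ : ℝ) :
      Integrable (fun x => c₂ * x ^ 2 + c₁ * x + c₀) ν ∧
      ∫ x, (c₂ * x ^ 2 + c₁ * x + c₀) ∂ν = c₂ * ∫ x, x ^ 2 ∂ν + c₁ * ∫ x, x ∂ν + c₀ := by
    have h₁ : Integrable (fun x : ℝ => c₁ * x) ν := (h.integrable one_le_two).const_mul _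
    have h₂ : Integrable (fun x : ℝ => c₂ * x ^ 2) ν := h.integrable_sq.const_mul _
    refine ⟨(h₂.add h₁).add (integrable_const _), ?_⟩
    calc ∫ x, (c₂ * x ^ 2 + c₁ * x + c₀) ∂ν
        = ∫ x, (c₂ * x ^ 2 + c₁ * x) ∂ν + ∫ _, c₀ ∂ν :=
          integral_add (h₂.add h₁) (integrable_const _)
      _ = _ := by
          rw [integral_add h₂ h₁, integral_const_mul, integral_const_mul]
          simp
  by_contra! hcon
  have key (c₂ c₁ c₀ : ℝ) (hc₂ : 0 ≤ c₂) (h₀ : {x : ℝ | c₂ * x ^ 2 + c₁ * x + c₀ = 0}.Finite)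
      (hpos : ∀ x ∈ A, c₂ * x ^ 2 + c₁ * x + c₀ ≤ 0)
      (hneg : ∀ x ∉ A, 0 ≤ c₂ * x ^ 2 + c₁ * x + c₀) : False := by
    obtain ⟨hi, he⟩ := hdiff (hquad hγ c₂ c₁ c₀).1 (hquad hν c₂ c₁ c₀).1
    rw [(hquad hγ c₂ c₁ c₀).2, (hquad hν c₂ c₁ c₀).2, hmean] at he
    have hle : ∀ᵐ x ∂γ, 0 ≤ -((c₂ * x ^ 2 + c₁ * x + c₀) * ((k x).toReal - 1)) := by
      filter_upwards [hfin] with x hx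
      by_cases hxA : x ∈ A
      · have : 1 ≤ (k x).toReal := by
          simpa using ENNReal.toReal_mono hx.ne (le_of_lt (show 1 < k x from hxA))
        nlinarith [hpos x hxA]
      · have : (k x).toReal ≤ 1 := by
          simpa using ENNReal.toReal_mono ENNReal.one_ne_top (not_lt.1 (show ¬ 1 < k x from hxA))
        nlinarith [hneg x hxA]
    have h₁ : ∫ x, -((c₂ * x ^ 2 + c₁ * x + c₀) * ((k x).toReal - 1)) ∂γ = 0 := by
      refine le_antisymm ?_ (integral_nonneg_of_ae hle)
      rw [integral_neg, he]
      nlinarith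
    rw [integral_eq_zero_iff_of_nonneg_ae hle hi.neg] at h₁
    refine hne ?_
    have h₂ : ∀ᵐ x ∂γ, x ∉ {x : ℝ | c₂ * x ^ 2 + c₁ * x + c₀ = 0} :=
      measure_eq_zero_iff_ae_notMem.1 (h₀.measure_zero γ)
    filter_upwards [hfin, h₁, h₂] with x hx hx₁ hx₂
    have : (k x).toReal - 1 = 0 := by
      simpa using (mul_eq_zero.1 (neg_eq_zero.1 hx₁)).resolve_left hx₂
    rw [← ENNReal.ofReal_toReal hx.ne, sub_eq_zero.1 this, ENNReal.ofReal_one]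
  rcases A.eq_empty_or_nonempty with hA₀ | hA₀
  · exact key 0 0 1 le_rfl (by simp) (by simp [hA₀]) (by simp)
  by_cases hb : BddBelow A <;> by_cases ha : BddAbove A
  · have hbelow : ∀ x ∉ A, sInf A < x → sSup A ≤ x := by
      intro x hx h
      obtain ⟨y, hy, hyx⟩ := exists_lt_of_csInf_lt hA₀ h
      refine csSup_le hA₀ fun z hz => ?_
      by_contra! hxz
      exact hx (hk₁.out hy hz ⟨hyx.le, hxz.le⟩)
    have hfac (x : ℝ) : 1 * x ^ 2 + -(sInf A + sSup A) * x + sInf A * sSup A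
        = (x - sInf A) * (x - sSup A) := by ring
    refine key 1 (-(sInf A + sSup A)) (sInf A * sSup A) zero_le_one ?_ ?_ ?_
    · simp only [hfac, mul_eq_zero, sub_eq_zero]
      exact Set.toFinite {sInf A, sSup A}
    · intro x hx
      rw [hfac]
      nlinarith [csInf_le hb hx, le_csSup ha hx]
    · intro x hx
      rw [hfac]
      have hIS := csInf_le_csSup hA₀ hb ha
      rcases le_or_gt x (sInf A) with h | h
      · nlinarith
      · nlinarith [hbelow x hx h]
  · refine key 0 (-1) (sInf A) le_rfl ?_ ?_ ?_
    · refine (Set.finite_singleton (sInf A)).subset fun x (hx : _ = _) => ?_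
      simp only [Set.mem_singleton_iff]
      linarith
    · intro x hx
      linarith [csInf_le hb hx]
    · intro x hx
      by_contra! h
      obtain ⟨y, hy, hyx⟩ := exists_lt_of_csInf_lt hA₀ (show sInf A < x by linarith)
      obtain ⟨z, hz, hxz⟩ := not_bddAbove_iff.1 ha x
      exact hx (hk₁.out hy hz ⟨hyx.le, hxz.le⟩)
  · refine key 0 1 (-sSup A) le_rfl ?_ ?_ ?_
    · refine (Set.finite_singleton (sSup A)).subset fun x (hx : _ = _) => ?_
      simp only [Set.mem_singleton_iff]
      linarith
    · intro x hx
      linarith [le_csSup ha hx]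
    · intro x hx
      by_contra! h
      obtain ⟨y, hy, hyx⟩ := exists_lt_of_lt_csSup hA₀ (show x < sSup A by linarith)
      obtain ⟨z, hz, hxz⟩ := not_bddBelow_iff.1 hb x
      exact hx (hk₁.out hz hy ⟨hxz.le, hyx.le⟩)
  · refine key 0 0 (-1) le_rfl (by simp) (by simp) fun x hx => (hx ?_).elim
    obtain ⟨y, hy, hyx⟩ := not_bddAbove_iff.1 ha x
    obtain ⟨z, hz, hxz⟩ := not_bddBelow_iff.1 hb x
    exact hk₁.out hz hy ⟨hxz.le, hyx.le⟩

theorem exists_measurePreserving_prod_inner_eq_fst {n : ℕ} {σ : EuclideanSpace ℝ (Fin n)}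
    (hσ : ‖σ‖ = 1) :
    ∃ (d : ℕ) (Φ : ℝ × (Fin d → ℝ) →ₗ[ℝ] EuclideanSpace ℝ (Fin n)),
      MeasurePreserving Φ ∧ ∀ p, ⟪σ, Φ p⟫ = p.1 := by
  cases n with
  | zero => simp [Subsingleton.elim σ 0] at hσ
  | succ d =>
    obtain ⟨b, hb⟩ := Orthonormal.exists_orthonormalBasis_extension_of_card_eq (𝕜 := ℝ)
      (E := EuclideanSpace ℝ (Fin (d + 1))) (ι := Fin (d + 1)) (by simp) (v := fun _ => σ)
      (s := {0}) ⟨fun _ => hσ, fun i j hij => (hij (Subsingleton.elim i j)).elim⟩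
    have hb : b 0 = σ := hb 0 rfl
    refine ⟨d, b.repr.symm.toLinearMap ∘ₗ (WithLp.linearEquiv 2 ℝ (Fin (d + 1) → ℝ)).symm ∘ₗ
      (Fin.consLinearEquiv ℝ fun _ : Fin (d + 1) => ℝ).toLinearMap, ?_, fun p => ?_⟩
    · convert! b.measurePreserving_repr_symm.comp ((PiLp.volume_preserving_toLp (Fin (d + 1))).comp
        (volume_preserving_piFinSuccAbove (fun _ : Fin (d + 1) => ℝ) 0).symm) using 1
      ext p
      simp [MeasurableEquiv.piFinSuccAbove, Fin.insertNthEquiv, Fin.consLinearEquiv]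
      rfl
    · rw [← hb, ← b.repr_apply_apply]
      simp [Fin.consLinearEquiv]

theorem ordConnected_one_lt_lintegral_exp_neg {E : Type*} [AddCommGroup E] [Module ℝ E]
    [MeasurableSpace E] {d : ℕ} {U : E → ℝ} (hU : ConvexOn ℝ Set.univ U) (hUm : Measurable U)
    {Φ : ℝ × (Fin d → ℝ) →ₗ[ℝ] E} (hΦ : Measurable Φ) :
    {s : ℝ | 1 < ∫⁻ z, ENNReal.ofReal (Real.exp (-U (Φ (s, z))))}.OrdConnected := by
  refine Convex.ordConnected (convex_iff_forall_pos.2 fun s hs t ht a b ha hb hab => ?_)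
  have hm (s : ℝ) : Measurable fun z => ENNReal.ofReal (Real.exp (-U (Φ (s, z)))) := by fun_prop
  refine lt_of_lt_of_le (?_ : (1 : ℝ≥0∞) < _)
    (prekopaLeindler_pi ha hb hab d (hm s) (hm t) (hm _) fun z w => ?_)
  · calc (1 : ℝ≥0∞) = 1 ^ a * 1 ^ b := by simp
      _ < _ := ENNReal.mul_lt_mul (ENNReal.rpow_lt_rpow hs ha) (ENNReal.rpow_lt_rpow ht hb)
  · have h : Φ (a • s + b • t, a • z + b • w) = a • Φ (s, z) + b • Φ (t, w) := by
      rw [← map_smul, ← map_smul, ← map_add]; rfl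
    rw [h, ENNReal.ofReal_rpow_of_pos (Real.exp_pos _), ENNReal.ofReal_rpow_of_pos (Real.exp_pos _),
      ← ENNReal.ofReal_mul (by positivity), ← Real.exp_mul, ← Real.exp_mul, ← Real.exp_add]
    refine ENNReal.ofReal_le_ofReal (Real.exp_le_exp.2 ?_)
    have := hU.2 (Set.mem_univ (Φ (s, z))) (Set.mem_univ (Φ (t, w))) ha.le hb.le hab
    simp only [smul_eq_mul] at this
    linarith

theorem convexOn_norm_sub_sq_sub_inner_sub_sq {E : Type*} [NormedAddCommGroup E]
    [InnerProductSpace ℝ E] {σ : E} (hσ : ‖σ‖ = 1) (m : E) (c : ℝ) :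
    ConvexOn ℝ Set.univ fun x => ‖x - m‖ ^ 2 - (⟪σ, x⟫ - c) ^ 2 := by
  refine ⟨convex_univ, fun x _ y _ a b ha hb hab => ?_⟩
  have hcs : ⟪σ, x - y⟫ ^ 2 ≤ ‖x - y‖ ^ 2 := by
    simpa [hσ, sq_abs] using pow_le_pow_left₀ (abs_nonneg _) (abs_real_inner_le_norm σ (x - y)) 2
  have hx : x - y = (x - m) - (y - m) := by abel
  have hm : a • x + b • y - m = a • (x - m) + b • (y - m) := by
    rw [smul_sub, smul_sub, sub_add_sub_comm, ← add_smul, hab, one_smul]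
  rw [hx, norm_sub_sq_real, ← hx, inner_sub_right] at hcs
  simp only [hm, norm_add_sq_real, norm_smul, inner_add_right, inner_smul_right, inner_smul_left,
    smul_eq_mul, Real.norm_eq_abs, mul_pow, sq_abs, RCLike.conj_to_real]
  obtain rfl : b = 1 - a := by linarith
  nlinarith [mul_le_mul_of_nonneg_left hcs (mul_nonneg ha hb)]

theorem lintegral_ofReal_exp_affine_eq_top (α β : ℝ) :
    ∫⁻ s : ℝ, ENNReal.ofReal (Real.exp (α * s + β)) = ∞ := by
  have h (S : Set ℝ) (hS : MeasurableSet S) (hvol : volume S = ∞) (hle : ∀ s ∈ S, 0 ≤ α * s) :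
      ∫⁻ s : ℝ, ENNReal.ofReal (Real.exp (α * s + β)) = ∞ := by
    refine top_unique ?_
    calc ∞ = ∫⁻ _ in S, ENNReal.ofReal (Real.exp β) := by
          simp [hvol, ENNReal.mul_top, Real.exp_pos]
      _ ≤ ∫⁻ s in S, ENNReal.ofReal (Real.exp (α * s + β)) := by
          refine setLIntegral_mono (by fun_prop) fun s hs => ?_
          exact ENNReal.ofReal_le_ofReal (Real.exp_le_exp.2 (by linarith [hle s hs]))
      _ ≤ _ := setLIntegral_le_lintegral _ _
  rcases le_total 0 α with hα | hα
  · exact h (Set.Ici 0) measurableSet_Ici (by simp) fun s hs => mul_nonneg hα hs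
  · exact h (Set.Iic 0) measurableSet_Iic (by simp) fun s hs => mul_nonneg_of_nonpos_of_nonpos hα hs

theorem map_withDensity_eq_withDensity_lintegral {E F : Type*} [MeasurableSpace E]
    [MeasurableSpace F] {μ : Measure E} {ν : Measure F} [SFinite ν] {Φ : ℝ × F → E}
    (hΦ : MeasurePreserving Φ (volume.prod ν) μ) {T : E → ℝ} (hT : Measurable T)
    (hTΦ : ∀ p, T (Φ p) = p.1) {f : E → ℝ≥0∞} (hf : Measurable f) :
    (μ.withDensity f).map T = volume.withDensity fun s => ∫⁻ z, f (Φ (s, z)) ∂ν := by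
  ext S hS
  have hm : Measurable fun p => (T ⁻¹' S).indicator f (Φ p) :=
    (hf.indicator (hT hS)).comp hΦ.measurable
  rw [Measure.map_apply hT hS, withDensity_apply _ (hT hS), withDensity_apply _ hS,
    ← lintegral_indicator (hT hS), ← hΦ.lintegral_comp (hf.indicator (hT hS)),
    lintegral_prod _ hm.aemeasurable,
    ← lintegral_indicator hS]
  refine lintegral_congr fun s => ?_
  by_cases hs : s ∈ S <;> simp [Set.indicator, hTΦ, hs]

/-- **Strict variance bound for Gaussian-reweighted log-concave measures.**
For a log-concave probability density `ρ = e^{-V}` on `ℝⁿ`, `δ > 0` and `m ∈ ℝⁿ`, let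
`μ_{m,δ}` be the probability measure with density proportional to `e^{-δ|x-m|²/2} ρ(x)`.
Then for each unit vector `σ`, `Var_{μ_{m,δ}}(x ↦ ⟨σ,x⟩) < 1/δ`. -/
theorem reweighted_log_concave_variance_lt
    {n : ℕ} (V : EuclideanSpace ℝ (Fin n) → ℝ) (hV : ConvexOn ℝ Set.univ V)
    (hρ : (∫ x, Real.exp (-V x)) = 1)
    (δ : ℝ) (hδ : 0 < δ) (m : EuclideanSpace ℝ (Fin n))
    (Z : ℝ) (hZ : Z = ∫ x, Real.exp (-(δ * ‖x - m‖ ^ 2 / 2)) * Real.exp (-V x))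
    (μ : Measure (EuclideanSpace ℝ (Fin n)))
    (hμ : μ = volume.withDensity
      (fun x => ENNReal.ofReal (Real.exp (-(δ * ‖x - m‖ ^ 2 / 2)) * Real.exp (-V x) / Z)))
    (σ : EuclideanSpace ℝ (Fin n)) (hσ : ‖σ‖ = 1) :
    (∫ x, ⟪σ, x⟫ ^ 2 ∂μ) - (∫ x, ⟪σ, x⟫ ∂μ) ^ 2 < 1 / δ := by
  have hδ' : 0 < 1 / δ := by positivity
  by_cases hZ₀ : Z = 0
  · simpa [hμ, hZ₀] using hδ
  by_cases hint : Integrable (fun x => ⟪σ, x⟫ ^ 2) μ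
  swap
  · rw [integral_undef hint]
    nlinarith [sq_nonneg (∫ x, ⟪σ, x⟫ ∂μ)]
  have hVm : Measurable V :=
    (continuousOn_univ.1 (hV.continuousOn isOpen_univ)).measurable
  have hZint : Integrable fun x => Real.exp (-(δ * ‖x - m‖ ^ 2 / 2)) * Real.exp (-V x) := by
    by_contra h
    exact hZ₀ (hZ.trans (integral_undef h))
  have hZpos : 0 < Z := by
    refine lt_of_le_of_ne ?_ (Ne.symm hZ₀)
    rw [hZ]
    exact integral_nonneg fun x => by positivity
  have hμprob : IsProbabilityMeasure μ := by
    refine ⟨?_⟩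
    rw [hμ, withDensity_apply _ MeasurableSet.univ, setLIntegral_univ,
      ← ofReal_integral_eq_lintegral_ofReal (hZint.div_const Z)
        (Filter.Eventually.of_forall fun x => by positivity), integral_div, ← hZ,
      div_self hZ₀, ENNReal.ofReal_one]
  obtain ⟨d, Φ, hΦ, hσΦ⟩ := exists_measurePreserving_prod_inner_eq_fst hσ
  have hTm : Measurable fun x : EuclideanSpace ℝ (Fin n) => ⟪σ, x⟫ := by fun_prop
  set b := ∫ x, ⟪σ, x⟫ ∂μ
  let v : NNReal := ⟨1 / δ, hδ'.le⟩
  have hv : v ≠ 0 := fun h => hδ'.ne' (congrArg NNReal.toReal h)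
  set γ := ProbabilityTheory.gaussianReal b v with hγ
  obtain ⟨c, hc⟩ : ∃ c, Real.exp c = √(2 * Real.pi * v) / Z :=
    ⟨_, Real.exp_log (by have : (0 : ℝ) < v := hδ'
                         positivity)⟩
  let U : EuclideanSpace ℝ (Fin n) → ℝ :=
    fun x => V x + δ / 2 * (‖x - m‖ ^ 2 - (⟪σ, x⟫ - b) ^ 2) - c
  have hUconv : ConvexOn ℝ Set.univ U :=
    (hV.add ((convexOn_norm_sub_sq_sub_inner_sub_sq hσ m b).smul (by positivity))).sub
      (concaveOn_const c convex_univ)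
  have hUm : Measurable U := by fun_prop
  have hdens (x : EuclideanSpace ℝ (Fin n)) :
      ENNReal.ofReal (Real.exp (-(δ * ‖x - m‖ ^ 2 / 2)) * Real.exp (-V x) / Z)
      = ProbabilityTheory.gaussianPDF b v ⟪σ, x⟫ * ENNReal.ofReal (Real.exp (-U x)) := by
    have hs : √(2 * Real.pi * v) ≠ 0 := by
      have : (0 : ℝ) < v := hδ'
      positivity
    rw [ProbabilityTheory.gaussianPDF,
      ← ENNReal.ofReal_mul (ProbabilityTheory.gaussianPDFReal_nonneg _ _ _),
      ProbabilityTheory.gaussianPDFReal]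
    congr 1
    have hexp : -(⟪σ, x⟫ - b) ^ 2 / (2 * (v : ℝ)) = -(δ / 2 * (⟪σ, x⟫ - b) ^ 2) := by
      change -(⟪σ, x⟫ - b) ^ 2 / (2 * (1 / δ)) = _
      field_simp
    have hU : -U x = δ / 2 * (⟪σ, x⟫ - b) ^ 2 + -(δ * ‖x - m‖ ^ 2 / 2) + -V x + c := by
      simp only [U]; ring
    rw [hexp, hU, Real.exp_add, Real.exp_add, Real.exp_add, hc, Real.exp_neg (_ * _)]
    field_simp
  set k : ℝ → ℝ≥0∞ := fun s => ∫⁻ z, ENNReal.ofReal (Real.exp (-U (Φ (s, z))))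
  have hUΦ : Measurable fun p => ENNReal.ofReal (Real.exp (-U (Φ p))) := by
    have := hΦ.measurable
    fun_prop
  have hkm : Measurable k := hUΦ.lintegral_prod_right'
  have hmap : μ.map (fun x => ⟪σ, x⟫) = γ.withDensity k := by
    rw [hμ, map_withDensity_eq_withDensity_lintegral hΦ hTm hσΦ (by fun_prop), hγ,
      ProbabilityTheory.gaussianReal_of_var_ne_zero _ hv,
      ← withDensity_mul _ (ProbabilityTheory.measurable_gaussianPDF _ _) hkm]
    congr 1
    ext s
    simp only [hdens, hσΦ]
    exact lintegral_const_mul _ (hUΦ.comp measurable_prodMk_left)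
  have hprob : IsProbabilityMeasure (γ.withDensity k) :=
    hmap ▸ Measure.isProbabilityMeasure_map hTm.aemeasurable
  have hγL : MemLp id 2 γ := ProbabilityTheory.memLp_id_gaussianReal 2
  have hνL : MemLp id 2 (γ.withDensity k) := by
    rw [← hmap, memLp_map_measure_iff (by fun_prop) hTm.aemeasurable]
    exact (memLp_two_iff_integrable_sq hTm.aestronglyMeasurable).2 hint
  have hmean : ∫ x, x ∂γ.withDensity k = b := by
    rw [← hmap, integral_map hTm.aemeasurable (by fun_prop)]
  have hsq : ∫ x, x ^ 2 ∂γ.withDensity k = ∫ x, ⟪σ, x⟫ ^ 2 ∂μ := by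
    rw [← hmap, integral_map hTm.aemeasurable (by fun_prop)]
  have hγmean : ∫ x, x ∂γ = b := ProbabilityTheory.integral_id_gaussianReal
  have hγsq : ∫ x, x ^ 2 ∂γ = 1 / δ + b ^ 2 := by
    have h : ProbabilityTheory.variance id γ = v := ProbabilityTheory.variance_id_gaussianReal
    rw [ProbabilityTheory.variance_eq_sub hγL] at h
    simp only [Pi.pow_apply, id, hγmean] at h
    have hv' : (v : ℝ) = 1 / δ := rfl
    linarith
  have : NullSingletonClass γ := ProbabilityTheory.nullSingletonClass_gaussianReal hv
  have hlt := integral_sq_withDensity_lt_of_ordConnected hγL hkm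
    (ordConnected_one_lt_lintegral_exp_neg hUconv hUm hΦ.measurable) hνL
    (hmean.trans hγmean.symm) ?_
  · rw [hsq, hγsq] at hlt
    linarith
  intro hk₁
  have hk₂ : ∀ᵐ s, k s = 1 :=
    (ProbabilityTheory.gaussianReal_absolutelyContinuous' b hv).ae_le hk₁
  have hρint : Integrable fun x => Real.exp (-V x) := by
    by_contra h
    simp [integral_undef h] at hρ
  have hfin : ∫⁻ x, ENNReal.ofReal (Real.exp (-V x)) < ∞ := hρint.lintegral_lt_top
  refine hfin.ne (top_unique ?_)
  set α := δ * (b - ⟪σ, m⟫) with hα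
  set β := δ / 2 * (⟪σ, m⟫ ^ 2 - b ^ 2) - c with hβ
  calc ∞ = ∫⁻ s : ℝ, ENNReal.ofReal (Real.exp (α * s + β)) :=
        (lintegral_ofReal_exp_affine_eq_top α β).symm
    _ = ∫⁻ s : ℝ, ENNReal.ofReal (Real.exp (α * s + β)) * k s := by
        refine lintegral_congr_ae ?_
        filter_upwards [hk₂] with s hs
        rw [hs, mul_one]
    _ = ∫⁻ s : ℝ, ∫⁻ z, ENNReal.ofReal (Real.exp (α * s + β)) *
          ENNReal.ofReal (Real.exp (-U (Φ (s, z)))) :=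
        lintegral_congr fun s => (lintegral_const_mul _ (hUΦ.comp measurable_prodMk_left)).symm
    _ ≤ ∫⁻ s : ℝ, ∫⁻ z, ENNReal.ofReal (Real.exp (-V (Φ (s, z)))) := by
        refine lintegral_mono fun s => lintegral_mono fun z => ?_
        rw [← ENNReal.ofReal_mul (by positivity), ← Real.exp_add]
        refine ENNReal.ofReal_le_ofReal (Real.exp_le_exp.2 ?_)
        have hcs : (s - ⟪σ, m⟫) ^ 2 ≤ ‖Φ (s, z) - m‖ ^ 2 := by
          have := pow_le_pow_left₀ (abs_nonneg _) (abs_real_inner_le_norm σ (Φ (s, z) - m)) 2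
          simpa [hσ, sq_abs, inner_sub_right, hσΦ] using this
        simp only [U, hσΦ, hα, hβ]
        nlinarith [mul_le_mul_of_nonneg_left hcs hδ.le]
    _ = ∫⁻ x, ENNReal.ofReal (Real.exp (-V x)) := by
        have hm : Measurable fun x => ENNReal.ofReal (Real.exp (-V x)) := by fun_prop
        rw [← hΦ.lintegral_comp hm]
        exact (lintegral_prod _ (hm.comp hΦ.measurable).aemeasurable).symm
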